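/- Let K have characteristic 2 and let k > 1 be odd. In A = A^{k,s}(a,c): (i) if c = 0 then T₁(A) = [A,A] + span_K({α} ∪ {η^t : s/2 < t ≤ s−1} ∪ {(βγα)^m : (k−1)/2 < m ≤ k}); (ii) if c ≠ 0 and either s is odd or c is not a square in K, then T₁(A) = [A,A] + span_K({η^t : s/2 < t ≤ s−1} ∪ {(βγα)^m : (k−1)/2 < m ≤ k}); (iii) if s is even and c = d² for some nonzero d ∈ K, then T₁(A) = [A,A] + span_K({α + dη^{s/2}} ∪ {η^t : s/2 < t ≤ s−1} ∪ {(βγα)^m : (k−1)/2 < m ≤ k}). -/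

import Mathlib

namespace QT

/-- The generators of the free algebra: the two vertex idempotents `e1, e2`,
the loops `al` (α at vertex 1) and `et` (η at vertex 2), and the arrows
`be` (β : 1 → 2) and `ga` (γ : 2 → 1). -/
inductive Gen : Type
  | e1 : Gen
  | e2 : Gen
  | al : Gen
  | be : Gen
  | ga : Gen
  | et : Gen

open Gen

/-- Generators as elements of the free algebra. -/
noncomputable def gen (K : Type) [Field K] (g : Gen) : FreeAlgebra K Gen :=
  FreeAlgebra.ι K g

/-- The defining relations of the algebra `A^{k,s}(a,c)`: the path-algebra
relations for the quiver with two vertices, loops α, η and arrows β, γ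
(paths composed left to right), together with the relations
βη = (αβγ)^{k−1}αβ, ηγ = (γαβ)^{k−1}γα, α² = a(βγα)^{k−1}βγ + c(βγα)^k,
γβ = η^{s−1}, α²β = 0, γα² = 0. -/
inductive Rel (K : Type) [Field K] (k s : ℕ) (a c : K) :
    FreeAlgebra K Gen → FreeAlgebra K Gen → Prop
  | idem1 : Rel K k s a c (gen K e1 * gen K e1) (gen K e1)
  | idem2 : Rel K k s a c (gen K e2 * gen K e2) (gen K e2)
  | orth12 : Rel K k s a c (gen K e1 * gen K e2) 0
  | orth21 : Rel K k s a c (gen K e2 * gen K e1) 0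
  | sum_idem : Rel K k s a c (gen K e1 + gen K e2) 1
  | al_left : Rel K k s a c (gen K e1 * gen K al) (gen K al)
  | al_right : Rel K k s a c (gen K al * gen K e1) (gen K al)
  | be_left : Rel K k s a c (gen K e1 * gen K be) (gen K be)
  | be_right : Rel K k s a c (gen K be * gen K e2) (gen K be)
  | ga_left : Rel K k s a c (gen K e2 * gen K ga) (gen K ga)
  | ga_right : Rel K k s a c (gen K ga * gen K e1) (gen K ga)
  | et_left : Rel K k s a c (gen K e2 * gen K et) (gen K et)
  | et_right : Rel K k s a c (gen K et * gen K e2) (gen K et)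
  | rel_beta_eta : Rel K k s a c (gen K be * gen K et)
      ((gen K al * gen K be * gen K ga) ^ (k - 1) * (gen K al * gen K be))
  | rel_eta_gamma : Rel K k s a c (gen K et * gen K ga)
      ((gen K ga * gen K al * gen K be) ^ (k - 1) * (gen K ga * gen K al))
  | rel_alpha_sq : Rel K k s a c (gen K al * gen K al)
      (a • ((gen K be * gen K ga * gen K al) ^ (k - 1) * (gen K be * gen K ga)) +
        c • (gen K be * gen K ga * gen K al) ^ k)
  | rel_gamma_beta : Rel K k s a c (gen K ga * gen K be) ((gen K et) ^ (s - 1))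
  | rel_alpha_sq_beta : Rel K k s a c (gen K al * gen K al * gen K be) 0
  | rel_gamma_alpha_sq : Rel K k s a c (gen K ga * (gen K al * gen K al)) 0

/-- The algebra `A^{k,s}(a,c)` of quaternion type with two simple modules. -/
abbrev Aa (K : Type) [Field K] (k s : ℕ) (a c : K) : Type :=
  RingQuot (Rel K k s a c)

variable (K : Type) [Field K] (k s : ℕ) (a c : K)

/-- The idempotent e₁ in `A^{k,s}(a,c)`. -/
noncomputable def E1 : Aa K k s a c := RingQuot.mkAlgHom K (Rel K k s a c) (gen K e1)
/-- The idempotent e₂ in `A^{k,s}(a,c)`. -/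
noncomputable def E2 : Aa K k s a c := RingQuot.mkAlgHom K (Rel K k s a c) (gen K e2)
/-- The loop α in `A^{k,s}(a,c)`. -/
noncomputable def Al : Aa K k s a c := RingQuot.mkAlgHom K (Rel K k s a c) (gen K al)
/-- The arrow β in `A^{k,s}(a,c)`. -/
noncomputable def Be : Aa K k s a c := RingQuot.mkAlgHom K (Rel K k s a c) (gen K be)
/-- The arrow γ in `A^{k,s}(a,c)`. -/
noncomputable def Ga : Aa K k s a c := RingQuot.mkAlgHom K (Rel K k s a c) (gen K ga)
/-- The loop η in `A^{k,s}(a,c)`. -/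
noncomputable def Et : Aa K k s a c := RingQuot.mkAlgHom K (Rel K k s a c) (gen K et)

/-- The commutator subspace [A,A]: the K-subspace spanned by all commutators. -/
noncomputable def comm : Submodule K (Aa K k s a c) :=
  Submodule.span K {z : Aa K k s a c | ∃ u v : Aa K k s a c, z = u * v - v * u}

/-- Index type for the basis B = B₁ ∪ B₂ ∪ B₃ ∪ B₄ of `A^{k,s}(a,c)`. -/
abbrev BIdx (k s : ℕ) : Type :=
  ((Fin k ⊕ Fin k) ⊕ (Fin (k - 1) ⊕ Fin (k + 1))) ⊕
    ((Fin (s + 1) ⊕ Fin (k - 1)) ⊕ ((Fin k ⊕ Fin k) ⊕ (Fin k ⊕ Fin k)))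

/-- The family of elements of `A^{k,s}(a,c)` given by
B₁ = {α(βγα)^n, (βγα)^nβγ : 0 ≤ n ≤ k−1} ∪ {(βγα)^m : 1 ≤ m ≤ k−1} ∪ {(αβγ)^ℓ : 0 ≤ ℓ ≤ k},
B₂ = {η^t : 0 ≤ t ≤ s} ∪ {(γαβ)^m : 1 ≤ m ≤ k−1},
B₃ = {(βγα)^nβ, α(βγα)^nβ : 0 ≤ n ≤ k−1},
B₄ = {(γαβ)^nγ, (γαβ)^nγα : 0 ≤ n ≤ k−1}. -/
noncomputable def bVec : BIdx k s → Aa K k s a c := fun i =>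
  let α := Al K k s a c
  let β := Be K k s a c
  let γ := Ga K k s a c
  let η := Et K k s a c
  match i with
  | .inl (.inl (.inl n)) => α * (β * γ * α) ^ (n : ℕ)
  | .inl (.inl (.inr n)) => (β * γ * α) ^ (n : ℕ) * (β * γ)
  | .inl (.inr (.inl m)) => (β * γ * α) ^ ((m : ℕ) + 1)
  | .inl (.inr (.inr l)) => (α * β * γ) ^ (l : ℕ)
  | .inr (.inl (.inl t)) => η ^ (t : ℕ)
  | .inr (.inl (.inr m)) => (γ * α * β) ^ ((m : ℕ) + 1)
  | .inr (.inr (.inl (.inl n))) => (β * γ * α) ^ (n : ℕ) * β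
  | .inr (.inr (.inl (.inr n))) => α * (β * γ * α) ^ (n : ℕ) * β
  | .inr (.inr (.inr (.inl n))) => (γ * α * β) ^ (n : ℕ) * γ
  | .inr (.inr (.inr (.inr n))) => (γ * α * β) ^ (n : ℕ) * (γ * α)

/-- `ψ` is the linear form on `A^{k,s}(a,c)` sending η^s and (αβγ)^k to 1 and every
other element of the basis B to 0. -/
noncomputable def IsPsi (ψ : Aa K k s a c →ₗ[K] K) : Prop :=
  ψ ((Et K k s a c) ^ s) = 1 ∧
  ψ ((Al K k s a c * Be K k s a c * Ga K k s a c) ^ k) = 1 ∧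
  ∀ i : BIdx k s, bVec K k s a c i ≠ (Et K k s a c) ^ s →
    bVec K k s a c i ≠ (Al K k s a c * Be K k s a c * Ga K k s a c) ^ k →
    ψ (bVec K k s a c i) = 0

/-- The set T₁(A) = {x ∈ A : x² ∈ [A,A]} (characteristic 2). -/
noncomputable def T1 : Set (Aa K k s a c) :=
  {z : Aa K k s a c | z ^ 2 ∈ comm K k s a c}

/-- The orthogonal space T₁(A)^⊥ of T₁(A) with respect to the symmetrising form
⟨u,v⟩ = ψ(uv): the space of all z with ψ(z·m) = 0 for all m ∈ T₁(A). -/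
noncomputable def perp (ψ : Aa K k s a c →ₗ[K] K) : Submodule K (Aa K k s a c) :=
  ⨅ m ∈ T1 K k s a c, LinearMap.ker (ψ ∘ₗ LinearMap.mulRight K m)

end QT

namespace QT

variable (K : Type) [Field K] (k s : ℕ) (a c : K)

/-- The set of powers η^t with n < 2t and t ≤ s−1 (i.e. n/2 < t ≤ s−1). -/
noncomputable def etaAbove (n : ℕ) : Set (Aa K k s a c) :=
  {z : Aa K k s a c | ∃ t : ℕ, n < 2 * t ∧ t ≤ s - 1 ∧ z = (Et K k s a c) ^ t}

/-- The set of powers (βγα)^m with n < 2m and m ≤ k (i.e. n/2 < m ≤ k). -/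
noncomputable def cycAbove (n : ℕ) : Set (Aa K k s a c) :=
  {z : Aa K k s a c | ∃ m : ℕ, n < 2 * m ∧ m ≤ k ∧
    z = (Be K k s a c * Ga K k s a c * Al K k s a c) ^ m}

end QT

structure QRep {K : Type} [Field K] {R : Type} [Ring R] [Algebra K R] (k s : ℕ) (a c : K)
    (e f α β γ η : R) : Prop where
  ee : e * e = e
  ff : f * f = f
  ef : e * f = 0
  fe : f * e = 0
  sum : e + f = 1
  eα : e * α = α
  αe : α * e = α
  eβ : e * β = β
  βf : β * f = β
  fγ : f * γ = γ
  γe : γ * e = γ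
  fη : f * η = η
  ηf : η * f = η
  βη : β * η = (α * β * γ) ^ (k - 1) * (α * β)
  ηγ : η * γ = (γ * α * β) ^ (k - 1) * (γ * α)
  αα : α * α = a • ((β * γ * α) ^ (k - 1) * (β * γ)) + c • (β * γ * α) ^ k
  γβ : γ * β = η ^ (s - 1)
  ααβ : α * α * β = 0
  γαα : γ * (α * α) = 0

namespace QRep
variable {K : Type} [Field K] {R : Type} [Ring R] [Algebra K R] {k s : ℕ} {a c : K}
    {e f α β γ η : R}

theorem shift1 (n : ℕ) : (α * β * γ) ^ n * α = α * (β * γ * α) ^ n := by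
  induction n with
  | zero => simp
  | succ n ih => rw [pow_succ', mul_assoc, ih, pow_succ']; noncomm_ring

theorem shift2 (n : ℕ) : (γ * α * β) ^ n * γ = γ * (α * β * γ) ^ n := by
  induction n with
  | zero => simp
  | succ n ih => rw [pow_succ', mul_assoc, ih, pow_succ']; noncomm_ring

theorem shift3 (n : ℕ) : (β * γ * α) ^ n * β = β * (γ * α * β) ^ n := by
  induction n with
  | zero => simp
  | succ n ih => rw [pow_succ', mul_assoc, ih, pow_succ']; noncomm_ring

variable (H : QRep k s a c e f α β γ η)
include H

theorem βη' : β * η = α * (β * γ * α) ^ (k - 1) * β := by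
  rw [H.βη, ← mul_assoc, shift1]

theorem ηγ' : η * γ = γ * α * (β * γ * α) ^ (k - 1) := by
  rw [H.ηγ, ← mul_assoc, shift2, mul_assoc, shift1, ← mul_assoc]

theorem z_eγ : e * γ = 0 := by rw [← H.fγ, ← mul_assoc, H.ef, zero_mul]
theorem z_eη : e * η = 0 := by rw [← H.fη, ← mul_assoc, H.ef, zero_mul]
theorem z_fα : f * α = 0 := by rw [← H.eα, ← mul_assoc, H.fe, zero_mul]
theorem z_fβ : f * β = 0 := by rw [← H.eβ, ← mul_assoc, H.fe, zero_mul]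
theorem z_αf : α * f = 0 := by rw [← H.αe, mul_assoc, H.ef, mul_zero]
theorem z_γf : γ * f = 0 := by rw [← H.γe, mul_assoc, H.ef, mul_zero]
theorem z_βe : β * e = 0 := by rw [← H.βf, mul_assoc, H.fe, mul_zero]
theorem z_ηe : η * e = 0 := by rw [← H.ηf, mul_assoc, H.fe, mul_zero]
theorem z_αγ : α * γ = 0 := by rw [← H.αe, mul_assoc, H.z_eγ, mul_zero]
theorem z_αη : α * η = 0 := by rw [← H.αe, mul_assoc, H.z_eη, mul_zero]
theorem z_γγ : γ * γ = 0 := by rw [← H.γe, mul_assoc, ← mul_assoc e, H.z_eγ, zero_mul, mul_zero]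
theorem z_γη : γ * η = 0 := by rw [← H.γe, mul_assoc, H.z_eη, mul_zero]
theorem z_βα : β * α = 0 := by rw [← H.βf, mul_assoc, H.z_fα, mul_zero]
theorem z_ββ : β * β = 0 := by rw [← H.βf, mul_assoc, ← mul_assoc f, H.z_fβ, zero_mul, mul_zero]
theorem z_ηα : η * α = 0 := by rw [← H.ηf, mul_assoc, H.z_fα, mul_zero]
theorem z_ηβ : η * β = 0 := by rw [← H.ηf, mul_assoc, H.z_fβ, mul_zero]

theorem z_γαα : γ * α * α = 0 := by rw [mul_assoc, H.γαα]

theorem z_αβη (hk : 1 < k) : α * β * η = 0 := by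
  obtain ⟨j, rfl⟩ : ∃ j, k = j + 2 := ⟨k - 2, by omega⟩
  rw [mul_assoc, H.βη, show j + 2 - 1 = j + 1 by omega, pow_succ']
  have : α * (α * β * γ * (α * β * γ) ^ j * (α * β)) =
    (α * α * β) * (γ * (α * β * γ) ^ j * (α * β)) := by noncomm_ring
  rw [this, H.ααβ, zero_mul]

theorem z_ηγα : η * γ * α = 0 := by
  rw [H.ηγ, mul_assoc, H.z_γαα, mul_zero]

theorem z_ηηγ (hk : 1 < k) : η * η * γ = 0 := by
  obtain ⟨j, rfl⟩ : ∃ j, k = j + 2 := ⟨k - 2, by omega⟩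
  rw [mul_assoc, H.ηγ', ← mul_assoc, ← mul_assoc, H.z_ηγα, zero_mul]

theorem z_βηη (hk : 1 < k) : β * η * η = 0 := by
  rw [H.βη, mul_assoc, H.z_αβη hk, mul_zero]

theorem z_βγβ (hk : 1 < k) (hs : 3 ≤ s) : β * γ * β = 0 := by
  obtain ⟨j, rfl⟩ : ∃ j, s = j + 3 := ⟨s - 3, by omega⟩
  rw [mul_assoc, H.γβ, show j + 3 - 1 = j + 1 + 1 by omega, pow_succ', pow_succ', ← mul_assoc,
    ← mul_assoc, H.z_βηη hk, zero_mul]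

/-- socle identity -/
theorem η_s (hk : 1 < k) (hs : 3 ≤ s) : η ^ s = (γ * α * β) ^ k := by
  obtain ⟨j, rfl⟩ : ∃ j, s = j + 3 := ⟨s - 3, by omega⟩
  obtain ⟨i, rfl⟩ : ∃ j, k = j + 2 := ⟨k - 2, by omega⟩
  have h := H.γβ
  rw [show j + 3 - 1 = j + 2 by omega] at h
  rw [show j + 3 = j + 2 + 1 by omega, pow_succ', ← h, ← mul_assoc, H.ηγ,
    show i + 2 - 1 = i + 1 by omega, pow_succ _ (i + 1), mul_assoc]

theorem z_η {t : ℕ} (hk : 1 < k) (hs : 3 ≤ s) (ht : s < t) : η ^ t = 0 := by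
  obtain ⟨j, rfl⟩ : ∃ j, t = s + 1 + j := ⟨t - s - 1, by omega⟩
  have h : η ^ (s + 1) = 0 := by
    obtain ⟨j, rfl⟩ : ∃ j, s = j + 3 := ⟨s - 3, by omega⟩
    have h := H.γβ
    rw [show j + 3 - 1 = j + 2 by omega] at h
    rw [show j + 3 + 1 = j + 2 + 1 + 1 by omega, pow_succ', pow_succ', ← h, ← mul_assoc, ← mul_assoc,
      H.z_ηηγ hk, zero_mul]
  rw [pow_add, h, zero_mul]

theorem z_x {t : ℕ} (hk : 1 < k) (hs : 3 ≤ s) (ht : k < t) : (β * γ * α) ^ t = 0 := by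
  obtain ⟨j, rfl⟩ : ∃ j, t = k + 1 + j := ⟨t - k - 1, by omega⟩
  have h : (β * γ * α) ^ (k + 1) = 0 := by
    obtain ⟨i, rfl⟩ : ∃ j, k = j + 1 := ⟨k - 1, by omega⟩
    obtain ⟨j, rfl⟩ : ∃ j, s = j + 3 := ⟨s - 3, by omega⟩
    have h1 := H.ηγ'
    rw [show i + 1 - 1 = i by omega] at h1
    have h3 := H.γβ
    rw [show j + 3 - 1 = j + 1 + 1 by omega, pow_succ'] at h3
    have : (β * γ * α) ^ (i + 1 + 1) = β * (γ * α * (β * γ * α) ^ i) * (β * γ * α) := by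
      rw [pow_succ, pow_succ']; noncomm_ring
    rw [this, ← h1]
    have : β * (η * γ) * (β * γ * α) = (β * η) * (γ * β) * (γ * α) := by noncomm_ring
    rw [this, h3, ← mul_assoc (β * η), H.z_βηη hk, zero_mul, zero_mul]
  rw [pow_add, h, zero_mul]

theorem ex_ne (n : ℕ) : e * (β * γ * α) ^ (n + 1) = (β * γ * α) ^ (n + 1) := by
  rw [pow_succ', ← mul_assoc, ← mul_assoc, ← mul_assoc, H.eβ]

omit H in
/-- spanning set -/
inductive G (e f α β γ η : R) : R → Prop
  | f : G e f α β γ η f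
  | γ : G e f α β γ η γ
  | η (t : ℕ) : G e f α β γ η (η ^ (t + 1))
  | w (p : R) (hp : p = e ∨ p = α ∨ p = γ * α) (n : ℕ) : G e f α β γ η (p * (β * γ * α) ^ n)
  | wβ (p : R) (hp : p = e ∨ p = α ∨ p = γ * α) (n : ℕ) : G e f α β γ η (p * (β * γ * α) ^ n * β)
  | wβγ (p : R) (hp : p = e ∨ p = α ∨ p = γ * α) (n : ℕ) :
      G e f α β γ η (p * (β * γ * α) ^ n * β * γ)

variable (K e f α β γ η) in
omit H in
def GS : Submodule K R := Submodule.span K {z | G e f α β γ η z}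

theorem we {p : R} (hp : p = e ∨ p = α ∨ p = γ * α) (n : ℕ) :
    p * (β * γ * α) ^ n * e = p * (β * γ * α) ^ n := by
  cases n with
  | zero =>
    rcases hp with rfl | rfl | rfl
    · simp [H.ee]
    · simp [H.αe]
    · simp [mul_assoc, H.αe]
  | succ n => rw [pow_succ]; simp only [mul_assoc, H.αe]

theorem wx {p : R} (hp : p = e ∨ p = α ∨ p = γ * α) (n : ℕ) {z : R} (hz : e * z = 0) :
    p * (β * γ * α) ^ n * z = 0 := by
  rw [← H.we hp n, mul_assoc, hz, mul_zero]

omit H in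
theorem GS.of {z : R} (h : G e f α β γ η z) : z ∈ GS K e f α β γ η := Submodule.subset_span h

theorem GS_mul (hk : 1 < k) (hs : 3 ≤ s) {g : R} (hg : g = e ∨ g = f ∨ g = α ∨ g = β ∨ g = γ ∨ g = η)
    {z : R} (hz : z ∈ GS K e f α β γ η) : z * g ∈ GS K e f α β γ η := by
  have h0 : (0 : R) ∈ GS K e f α β γ η := Submodule.zero_mem _
  unfold GS at hz
  induction hz using Submodule.span_induction with
  | zero => rw [zero_mul]; exact h0
  | add x y _ _ hx hy => rw [add_mul]; exact Submodule.add_mem _ hx hy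
  | smul r x _ hx => rw [smul_mul_assoc]; exact Submodule.smul_mem _ _ hx
  | mem x hx =>
    cases hx with
    | f =>
      rcases hg with rfl | rfl | rfl | rfl | rfl | rfl
      · rw [H.fe]; exact h0
      · rw [H.ff]; exact GS.of .f
      · rw [H.z_fα]; exact h0
      · rw [H.z_fβ]; exact h0
      · rw [H.fγ]; exact GS.of .γ
      · rw [H.fη]; simpa using GS.of (K := K) (.η (η := g) 0)
    | γ =>
      rcases hg with rfl | rfl | rfl | rfl | rfl | rfl
      · rw [H.γe]; exact GS.of .γ
      · rw [H.z_γf]; exact h0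
      · simpa using GS.of (K := K) (.w (γ * g) (.inr (.inr rfl)) 0)
      · rw [H.γβ, show s - 1 = s - 2 + 1 by omega]; exact GS.of (.η _)
      · rw [H.z_γγ]; exact h0
      · rw [H.z_γη]; exact h0
    | η t =>
      rcases hg with rfl | rfl | rfl | rfl | rfl | rfl
      · rw [pow_succ, mul_assoc, H.z_ηe, mul_zero]; exact h0
      · rw [pow_succ, mul_assoc, H.ηf, ← pow_succ]; exact GS.of (.η _)
      · rw [pow_succ, mul_assoc, H.z_ηα, mul_zero]; exact h0
      · rw [pow_succ, mul_assoc, H.z_ηβ, mul_zero]; exact h0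
      · cases t with
        | zero => 
          rw [zero_add, pow_one, H.ηγ']
          exact GS.of (.w _ (.inr (.inr rfl)) _)
        | succ t => rw [pow_succ, pow_succ, mul_assoc, mul_assoc, ← mul_assoc η, H.z_ηηγ hk,
                      mul_zero]; exact h0
      · rw [← pow_succ]; exact GS.of (.η _)
    | w p hp n =>
      rcases hg with rfl | rfl | rfl | rfl | rfl | rfl
      · rw [H.we hp]; exact GS.of (.w p hp n)
      · rw [H.wx hp n H.ef]; exact h0
      · cases n with
        | succ n =>
          rw [pow_succ]
          simp only [mul_assoc, H.γαα, mul_zero]; exact h0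
        | zero =>
          rw [pow_zero, mul_one]
          rcases hp with rfl | rfl | rfl
          · rw [H.eα]; simpa using GS.of (K := K) (.w g (.inr (.inl rfl)) 0)
          · rw [H.αα]
            refine Submodule.add_mem _ (Submodule.smul_mem _ _ ?_) (Submodule.smul_mem _ _ ?_)
            · obtain ⟨j, rfl⟩ : ∃ j, k = j + 2 := ⟨k - 2, by omega⟩
              rw [show j + 2 - 1 = j + 1 by omega, ← H.ex_ne, ← mul_assoc]
              exact GS.of (.wβγ e (.inl rfl) _)
            · obtain ⟨j, rfl⟩ : ∃ j, k = j + 1 := ⟨k - 1, by omega⟩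
              rw [← H.ex_ne]
              exact GS.of (.w e (.inl rfl) _)
          · rw [H.z_γαα]; exact h0
      · exact GS.of (.wβ p hp n)
      · rw [H.wx hp n H.z_eγ]; exact h0
      · rw [H.wx hp n H.z_eη]; exact h0
    | wβ p hp n =>
      rcases hg with rfl | rfl | rfl | rfl | rfl | rfl
      · rw [mul_assoc, H.z_βe, mul_zero]; exact h0
      · rw [mul_assoc, H.βf]; exact GS.of (.wβ p hp n)
      · rw [mul_assoc, H.z_βα, mul_zero]; exact h0
      · rw [mul_assoc, H.z_ββ, mul_zero]; exact h0
      · exact GS.of (.wβγ p hp n)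
      · have h1 : α * (β * g) = 0 := by rw [← mul_assoc, H.z_αβη hk]
        cases n with
        | succ n =>
          rw [pow_succ]
          simp only [mul_assoc, h1, mul_zero]; exact h0
        | zero =>
          rw [pow_zero, mul_one]
          rcases hp with rfl | rfl | rfl
          · rw [H.eβ, H.βη']
            exact GS.of (.wβ _ (.inr (.inl rfl)) _)
          · rw [mul_assoc, h1]; exact h0
          · rw [mul_assoc, mul_assoc, h1, mul_zero]; exact h0
    | wβγ p hp n =>
      rcases hg with rfl | rfl | rfl | rfl | rfl | rfl
      · rw [mul_assoc, H.γe]; exact GS.of (.wβγ p hp n)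
      · rw [mul_assoc, H.z_γf, mul_zero]; exact h0
      · have := GS.of (K := K) (.w (f := f) (η := η) (β := β) (α := g) (γ := γ) p hp (n + 1))
        rw [pow_succ] at this
        simpa only [mul_assoc] using this
      · rw [mul_assoc, mul_assoc, ← mul_assoc g, H.z_βγβ hk hs, mul_zero]; exact h0
      · rw [mul_assoc, H.z_γγ, mul_zero]; exact h0
      · rw [mul_assoc, H.z_γη, mul_zero]; exact h0

theorem GS_one : (1 : R) ∈ GS K e f α β γ η := by
  rw [← H.sum]
  refine Submodule.add_mem _ ?_ (GS.of .f)
  simpa using GS.of (K := K) (.w (f := f) (η := η) (α := α) (γ := γ) (β := β) e (.inl rfl) 0)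

omit H in
theorem rot {W : Submodule K R} (hC : ∀ u v : R, u * v - v * u ∈ W) {u v : R} (h : v * u ∈ W) :
    u * v ∈ W := by
  have := W.add_mem (hC u v) h
  rwa [sub_add_cancel] at this

theorem GS_le (hk : 1 < k) (hs : 3 ≤ s) {W : Submodule K R} (hC : ∀ u v : R, u * v - v * u ∈ W)
    (he : e ∈ W) (hf : f ∈ W) (hα : α ∈ W) (hη : ∀ t, 1 ≤ t → t ≤ s - 1 → η ^ t ∈ W)
    (hx : ∀ m, 1 ≤ m → m ≤ k → (β * γ * α) ^ m ∈ W) : GS K e f α β γ η ≤ W := by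
  have h0 : (0 : R) ∈ W := W.zero_mem
  have hx' : ∀ n, (β * γ * α) ^ (n + 1) ∈ W := by
    intro n
    by_cases h : n + 1 ≤ k
    · exact hx _ (by omega) h
    · rw [H.z_x hk hs (by omega)]; exact h0
  refine Submodule.span_le.2 ?_
  intro z hz
  change z ∈ W
  cases hz with
  | f => exact hf
  | γ => rw [← H.γe]; apply rot hC; rw [H.z_eγ]; exact h0
  | η t =>
    rcases lt_trichotomy (t + 1) s with h | h | h
    · exact hη _ (by omega) (by omega)
    · rw [h, H.η_s hk hs]
      obtain ⟨j, rfl⟩ : ∃ j, k = j + 1 := ⟨k - 1, by omega⟩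
      rw [pow_succ', mul_assoc]
      apply rot hC
      have := hx' j
      rw [pow_succ] at this
      rw [← shift3]
      simpa only [mul_assoc] using this
    · rw [H.z_η hk hs h]; exact h0
  | w p hp n =>
    rcases hp with rfl | rfl | rfl
    · cases n with
      | zero => simpa using he
      | succ n => rw [H.ex_ne]; exact hx' n
    · cases n with
      | zero => simpa using hα
      | succ n =>
        apply rot hC
        rw [pow_succ]
        simp only [mul_assoc, H.γαα, mul_zero]; exact h0
    · rw [mul_assoc]
      apply rot hC
      rw [H.wx (.inr (.inl rfl)) n H.z_eγ]; exact h0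
  | wβ p hp n =>
    rcases hp with rfl | rfl | rfl
    · apply rot hC
      rw [← mul_assoc, H.z_βe, zero_mul]; exact h0
    · apply rot hC
      rw [← mul_assoc, H.z_βα, zero_mul]; exact h0
    · rw [mul_assoc]
      apply rot hC
      have := hx' n
      rw [pow_succ] at this
      simpa only [mul_assoc] using this
  | wβγ p hp n =>
    rcases hp with rfl | rfl | rfl
    · cases n with
      | zero =>
        rw [pow_zero, mul_one, H.eβ]
        apply rot hC
        rw [H.γβ]; exact hη _ (by omega) (by omega)
      | succ n =>
        rw [H.ex_ne, pow_succ']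
        have : β * γ * α * (β * γ * α) ^ n * β * γ = β * (γ * α * (β * γ * α) ^ n * β * γ) := by
          simp only [mul_assoc]
        rw [this]
        apply rot hC
        rw [mul_assoc, mul_assoc, ← mul_assoc β, H.z_βγβ hk hs, mul_zero]; exact h0
    · rw [mul_assoc, mul_assoc]
      apply rot hC
      have := hx' n
      rw [pow_succ] at this
      simpa only [mul_assoc] using this
    · apply rot hC
      simp only [← mul_assoc]
      rw [H.z_γγ]; simp only [zero_mul]; exact h0

omit H in
theorem sq_add [CharP K 2] {W : Submodule K R} (hC : ∀ u v : R, u * v - v * u ∈ W) (x y : R) :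
    (x + y) ^ 2 - (x ^ 2 + y ^ 2) ∈ W := by
  have h2 : ∀ z : R, z + z = 0 := fun z => by
    rw [← two_smul K z, CharTwo.two_eq_zero, zero_smul]
  have : (x + y) ^ 2 - (x ^ 2 + y ^ 2) = (x * y - y * x) + (y * x + y * x) := by noncomm_ring
  rw [this, h2, add_zero]
  exact hC x y

omit H in
theorem sq_comm [CharP K 2] {W : Submodule K R} (hC : ∀ u v : R, u * v - v * u ∈ W) (u v : R) :
    (u * v - v * u) ^ 2 ∈ W := by
  have h2 : ∀ z : R, z + z = 0 := fun z => by
    rw [← two_smul K z, CharTwo.two_eq_zero, zero_smul]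
  have : (u * v - v * u) ^ 2 = (u * (v * u * v) - (v * u * v) * u) - (u * (v * v * u) - (v * v * u) * u)
      - (v * (u * u * v) - (u * u * v) * v) + ((v * u * v * u) + (v * u * v * u))
      - ((v * v * u * u - u * u * (v * v)) + (u * u * v * v + u * u * v * v)) := by noncomm_ring
  rw [this, h2, h2, add_zero, add_zero]
  refine W.sub_mem (W.sub_mem (W.sub_mem ?_ ?_) ?_) ?_ 
  · exact hC _ _
  · exact hC _ _
  · exact hC _ _
  · rw [mul_assoc]; exact hC _ _

theorem αα_mem (hk : 1 < k) (hs : 3 ≤ s) {W : Submodule K R} (hC : ∀ u v : R, u * v - v * u ∈ W) :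
    α ^ 2 - c • (β * γ * α) ^ k ∈ W := by
  rw [sq, H.αα, add_sub_cancel_right]
  refine W.smul_mem _ ?_
  obtain ⟨j, rfl⟩ : ∃ j, k = j + 2 := ⟨k - 2, by omega⟩
  rw [show j + 2 - 1 = j + 1 by omega, pow_succ']
  have : β * γ * α * (β * γ * α) ^ j * (β * γ) = β * (γ * α * (β * γ * α) ^ j * β * γ) := by
    simp only [mul_assoc]
  rw [this]
  apply rot hC
  rw [mul_assoc, mul_assoc, ← mul_assoc β, H.z_βγβ hk hs, mul_zero]; exact W.zero_mem

theorem ηs_mem (hk : 1 < k) (hs : 3 ≤ s) {W : Submodule K R} (hC : ∀ u v : R, u * v - v * u ∈ W) :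
    η ^ s - (β * γ * α) ^ k ∈ W := by
  rw [H.η_s hk hs]
  obtain ⟨j, rfl⟩ : ∃ j, k = j + 1 := ⟨k - 1, by omega⟩
  have h1 : (γ * α * β) ^ (j + 1) = (γ * α) * (β * (γ * α * β) ^ j) := by
    rw [pow_succ']; simp only [mul_assoc]
  have h2 : (β * γ * α) ^ (j + 1) = (β * (γ * α * β) ^ j) * (γ * α) := by
    rw [← shift3, pow_succ]; simp only [mul_assoc]
  rw [h1, h2]
  exact hC _ _

end QRep

namespace QT
section reps
open Polynomial Matrix Gen

theorem single_pow_succ {n : Type} [Fintype n] [DecidableEq n] {S : Type} [CommRing S] (i : n) (x : S)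
    (m : ℕ) : (single i i x) ^ (m + 1) = single i i (x ^ (m + 1)) := by
  induction m with
  | zero => simp
  | succ m ih => rw [pow_succ, ih, single_mul_single_same, ← pow_succ]

variable (K : Type) [Field K]

noncomputable def rM : FreeAlgebra K Gen →ₐ[K] Matrix (Fin 3) (Fin 3) K[X] :=
  FreeAlgebra.lift K fun g => match g with
    | e1 => single 0 0 1 + single 1 1 1
    | e2 => single 2 2 1
    | al => single 0 1 1
    | be => single 1 2 1
    | ga => single 2 0 X
    | et => 0

noncomputable def rN : FreeAlgebra K Gen →ₐ[K] Matrix (Fin 3) (Fin 3) K[X] :=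
  FreeAlgebra.lift K fun g => match g with
    | e1 => single 0 0 1
    | e2 => single 1 1 1 + single 2 2 1
    | al => 0
    | be => single 0 1 1
    | et => single 1 2 1
    | ga => single 2 0 X

noncomputable def rL : FreeAlgebra K Gen →ₐ[K] Matrix (Fin 2) (Fin 2) K[X] :=
  FreeAlgebra.lift K fun g => match g with
    | e1 => single 0 0 1
    | e2 => single 1 1 1
    | al => 0
    | be => single 0 1 1
    | et => 0
    | ga => single 1 0 X

noncomputable def rp : FreeAlgebra K Gen →ₐ[K] K[X] :=
  FreeAlgebra.lift K fun g => match g with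
    | e1 => 0
    | e2 => 1
    | al => 0
    | be => 0
    | et => X
    | ga => 0

noncomputable def rq : FreeAlgebra K Gen →ₐ[K] K[X] :=
  FreeAlgebra.lift K fun g => match g with
    | e1 => 1
    | e2 => 0
    | al => X
    | be => 0
    | et => 0
    | ga => 0

@[simp] theorem rM_e1 : rM K (gen K e1) = single 0 0 1 + single 1 1 1 := by simp [rM, gen]
@[simp] theorem rM_e2 : rM K (gen K e2) = single 2 2 1 := by simp [rM, gen]
@[simp] theorem rM_al : rM K (gen K al) = single 0 1 1 := by simp [rM, gen]
@[simp] theorem rM_be : rM K (gen K be) = single 1 2 1 := by simp [rM, gen]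
@[simp] theorem rM_ga : rM K (gen K ga) = single 2 0 X := by simp [rM, gen]
@[simp] theorem rM_et : rM K (gen K et) = 0 := by simp [rM, gen]
@[simp] theorem rN_e1 : rN K (gen K e1) = single 0 0 1 := by simp [rN, gen]
@[simp] theorem rN_e2 : rN K (gen K e2) = single 1 1 1 + single 2 2 1 := by simp [rN, gen]
@[simp] theorem rN_al : rN K (gen K al) = 0 := by simp [rN, gen]
@[simp] theorem rN_be : rN K (gen K be) = single 0 1 1 := by simp [rN, gen]
@[simp] theorem rN_ga : rN K (gen K ga) = single 2 0 X := by simp [rN, gen]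
@[simp] theorem rN_et : rN K (gen K et) = single 1 2 1 := by simp [rN, gen]
@[simp] theorem rL_e1 : rL K (gen K e1) = single 0 0 1 := by simp [rL, gen]
@[simp] theorem rL_e2 : rL K (gen K e2) = single 1 1 1 := by simp [rL, gen]
@[simp] theorem rL_al : rL K (gen K al) = 0 := by simp [rL, gen]
@[simp] theorem rL_be : rL K (gen K be) = single 0 1 1 := by simp [rL, gen]
@[simp] theorem rL_ga : rL K (gen K ga) = single 1 0 X := by simp [rL, gen]
@[simp] theorem rL_et : rL K (gen K et) = 0 := by simp [rL, gen]
@[simp] theorem rp_e1 : rp K (gen K e1) = 0 := by simp [rp, gen]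
@[simp] theorem rp_e2 : rp K (gen K e2) = 1 := by simp [rp, gen]
@[simp] theorem rp_al : rp K (gen K al) = 0 := by simp [rp, gen]
@[simp] theorem rp_be : rp K (gen K be) = 0 := by simp [rp, gen]
@[simp] theorem rp_ga : rp K (gen K ga) = 0 := by simp [rp, gen]
@[simp] theorem rp_et : rp K (gen K et) = X := by simp [rp, gen]
@[simp] theorem rq_e1 : rq K (gen K e1) = 1 := by simp [rq, gen]
@[simp] theorem rq_e2 : rq K (gen K e2) = 0 := by simp [rq, gen]
@[simp] theorem rq_al : rq K (gen K al) = X := by simp [rq, gen]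
@[simp] theorem rq_be : rq K (gen K be) = 0 := by simp [rq, gen]
@[simp] theorem rq_ga : rq K (gen K ga) = 0 := by simp [rq, gen]
@[simp] theorem rq_et : rq K (gen K et) = 0 := by simp [rq, gen]

structure Good (M N : Matrix (Fin 3) (Fin 3) K[X]) (L : Matrix (Fin 2) (Fin 2) K[X])
    (p q : K[X]) : Prop where
  M00 : (M 0 0).coeff 0 = q.coeff 0
  M11 : (M 1 1).coeff 0 = q.coeff 0
  M22 : (M 2 2).coeff 0 = p.coeff 0
  M10 : (M 1 0).coeff 0 = 0
  M20 : (M 2 0).coeff 0 = 0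
  M21 : (M 2 1).coeff 0 = 0
  M01 : (M 0 1).coeff 0 = q.coeff 1
  N00 : (N 0 0).coeff 0 = q.coeff 0
  N11 : (N 1 1).coeff 0 = p.coeff 0
  N22 : (N 2 2).coeff 0 = p.coeff 0
  N10 : (N 1 0).coeff 0 = 0
  N20 : (N 2 0).coeff 0 = 0
  N21 : (N 2 1).coeff 0 = 0
  N01 : (N 0 1).coeff 0 = (M 1 2).coeff 0
  N12 : (N 1 2).coeff 0 = p.coeff 1
  MN : (M 2 0).coeff 1 = (N 2 0).coeff 1
  L10 : (L 1 0).coeff 0 = 0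
  L11 : (L 1 1).coeff 0 = p.coeff 0

theorem good (y : FreeAlgebra K Gen) : Good K (rM K y) (rN K y) (rL K y) (rp K y) (rq K y) := by
  induction y with
  | grade0 r => 
    constructor <;> simp [Matrix.algebraMap_matrix_apply, AlgHom.commutes, coeff_C]
  | grade1 g =>
    change Good K (rM K (gen K g)) (rN K (gen K g)) (rL K (gen K g)) (rp K (gen K g)) (rq K (gen K g))
    cases g <;> constructor <;> simp [coeff_one]
  | add x y hx hy =>
    obtain ⟨a1, a2, a3, a4, a5, a6, a7, a8, a9, a10, a11, a12, a13, a14, a15, a16, a17, a18⟩ := hx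
    obtain ⟨b1, b2, b3, b4, b5, b6, b7, b8, b9, b10, b11, b12, b13, b14, b15, b16, b17, b18⟩ := hy
    constructor <;> simp [*]
  | mul x y hx hy =>
    obtain ⟨a1, a2, a3, a4, a5, a6, a7, a8, a9, a10, a11, a12, a13, a14, a15, a16, a17, a18⟩ := hx
    obtain ⟨b1, b2, b3, b4, b5, b6, b7, b8, b9, b10, b11, b12, b13, b14, b15, b16, b17, b18⟩ := hy
    constructor <;> simp [Matrix.mul_apply, Fin.sum_univ_three, mul_coeff_one, mul_coeff_zero, *]

structure IsTr (k s : ℕ) (a c : K) (Ψ : FreeAlgebra K Gen →ₗ[K] K) : Prop where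
  symm : ∀ x y, Ψ (x * y) = Ψ (y * x)
  rel : ∀ l r, Rel K k s a c l r → ∀ y, Ψ (l * y) = Ψ (r * y)

theorem IsTr.rel' {k s : ℕ} {a c : K} {Ψ : FreeAlgebra K Gen →ₗ[K] K} (h : IsTr K k s a c Ψ)
    {l r} (hr : RingQuot.Rel (Rel K k s a c) l r) : ∀ y, Ψ (l * y) = Ψ (r * y) := by
  induction hr with
  | of hr => exact h.rel _ _ hr
  | add_left _ ih => intro y; simp only [add_mul, map_add, ih]
  | mul_left _ ih => intro y; simp only [mul_assoc, ih]
  | mul_right _ ih => intro y; rw [mul_assoc, mul_assoc, h.symm, h.symm _ (_ * y), mul_assoc, mul_assoc, ih]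

theorem IsTr.desc {k s : ℕ} {a c : K} {Ψ : FreeAlgebra K Gen →ₗ[K] K} (h : IsTr K k s a c Ψ) :
    ∃ φ : Aa K k s a c →ₗ[K] K, (∀ y, φ (RingQuot.mkAlgHom K (Rel K k s a c) y) = Ψ y) ∧
      ∀ z ∈ comm K k s a c, φ z = 0 := by
  let φ0 : Aa K k s a c → K := fun z => Quot.lift Ψ (fun l r hr => by
    have := h.rel' K hr 1
    simpa using this) z.toQuot
  have h0 : ∀ y, φ0 (RingQuot.mkAlgHom K (Rel K k s a c) y) = Ψ y := by
    intro y
    simp only [φ0, RingQuot.mkAlgHom_def, RingQuot.mkRingHom_def]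
    rfl
  have hs := RingQuot.mkAlgHom_surjective K (Rel K k s a c)
  let φ : Aa K k s a c →ₗ[K] K := 
    { toFun := φ0
      map_add' := by
        intro x y
        obtain ⟨x, rfl⟩ := hs x
        obtain ⟨y, rfl⟩ := hs y
        rw [← map_add, h0, h0, h0, map_add]
      map_smul' := by
        intro r x
        obtain ⟨x, rfl⟩ := hs x
        rw [← map_smul, h0, h0, map_smul]; rfl }
  refine ⟨φ, h0, ?_⟩
  intro z hz
  have : comm K k s a c ≤ LinearMap.ker φ := by
    refine Submodule.span_le.2 ?_
    rintro _ ⟨u, v, rfl⟩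
    obtain ⟨u, rfl⟩ := hs u
    obtain ⟨v, rfl⟩ := hs v
    change φ _ = 0
    rw [map_sub, ← map_mul, ← map_mul, sub_eq_zero]
    exact (h0 _).trans ((h.symm u v).trans (h0 _).symm)
  exact this hz

variable {K}

theorem sM (n : ℕ) (i j : Fin 3) (r : K[X]) (M : Matrix (Fin 3) (Fin 3) K[X]) :
   (trace (single i j r * M)).coeff n = (r * M j i).coeff n := by
  rw [trace_single_mul, smul_eq_mul]

theorem M_βγα (m : ℕ) : (rM K (gen K be * gen K ga * gen K al)) ^ (m + 1) = single 1 1 (X ^ (m + 1)) := by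
  rw [← single_pow_succ]; simp
theorem M_αβγ (m : ℕ) : (rM K (gen K al * gen K be * gen K ga)) ^ (m + 1) = single 0 0 (X ^ (m + 1)) := by
  rw [← single_pow_succ]; simp
theorem M_γαβ (m : ℕ) : (rM K (gen K ga * gen K al * gen K be)) ^ (m + 1) = single 2 2 (X ^ (m + 1)) := by
  rw [← single_pow_succ]; simp
theorem N_βγα (m : ℕ) : (rN K (gen K be * gen K ga * gen K al)) ^ (m + 1) = 0 := by simp
theorem N_αβγ (m : ℕ) : (rN K (gen K al * gen K be * gen K ga)) ^ (m + 1) = 0 := by simp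
theorem N_γαβ (m : ℕ) : (rN K (gen K ga * gen K al * gen K be)) ^ (m + 1) = 0 := by simp
theorem L_βγα (m : ℕ) : (rL K (gen K be * gen K ga * gen K al)) ^ (m + 1) = 0 := by simp
theorem L_αβγ (m : ℕ) : (rL K (gen K al * gen K be * gen K ga)) ^ (m + 1) = 0 := by simp
theorem L_γαβ (m : ℕ) : (rL K (gen K ga * gen K al * gen K be)) ^ (m + 1) = 0 := by simp
theorem N_η (m : ℕ) : (rN K (gen K et)) ^ (m + 2) = 0 := by
  rw [pow_add, sq]; simp


theorem p_βγα (m : ℕ) : (rp K (gen K be * gen K ga * gen K al)) ^ (m + 1) = 0 := by simp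
theorem p_αβγ (m : ℕ) : (rp K (gen K al * gen K be * gen K ga)) ^ (m + 1) = 0 := by simp
theorem p_γαβ (m : ℕ) : (rp K (gen K ga * gen K al * gen K be)) ^ (m + 1) = 0 := by simp
theorem q_βγα (m : ℕ) : (rq K (gen K be * gen K ga * gen K al)) ^ (m + 1) = 0 := by simp
theorem q_αβγ (m : ℕ) : (rq K (gen K al * gen K be * gen K ga)) ^ (m + 1) = 0 := by simp
theorem q_γαβ (m : ℕ) : (rq K (gen K ga * gen K al * gen K be)) ^ (m + 1) = 0 := by simp

/-- the five representations packed -/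
def Val (x : FreeAlgebra K Gen) (M N : Matrix (Fin 3) (Fin 3) K[X]) (L : Matrix (Fin 2) (Fin 2) K[X])
    (p q : K[X]) : Prop := rM K x = M ∧ rN K x = N ∧ rL K x = L ∧ rp K x = p ∧ rq K x = q

theorem rel_cases {j i : ℕ} {a c : K} {l r : FreeAlgebra K Gen} (h : Rel K (j + 2) (i + 3) a c l r) :
    (∃ M N L p q, Val l M N L p q ∧ Val r M N L p q) ∨
    (Val l 0 (single 0 2 1) 0 0 0 ∧ Val r (single 0 2 (X ^ (j + 1))) 0 0 0 0) ∨
    (Val l 0 (single 1 0 X) 0 0 0 ∧ Val r (single 2 1 (X ^ (j + 2))) 0 0 0 0) ∨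
    (Val l 0 0 0 0 (X ^ 2) ∧ Val r (a • single 1 0 (X ^ (j + 2)) + c • single 1 1 (X ^ (j + 2))) 0 0 0 0) ∨
    (Val l 0 (single 2 1 X) (single 1 1 X) 0 0 ∧ Val r 0 0 0 (X ^ (i + 2)) 0) := by
  cases h
  case rel_beta_eta =>
    right; left
    refine ⟨⟨?_, ?_, ?_, ?_, ?_⟩, ⟨?_, ?_, ?_, ?_, ?_⟩⟩ <;> 
      (try simp only [show j + 2 - 1 = j + 1 by omega, map_mul _ (_ ^ _) _, map_pow _ _ (_ + _), M_αβγ, N_αβγ, L_αβγ, p_αβγ, q_αβγ]) <;> simp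
  case rel_eta_gamma =>
    right; right; left
    refine ⟨⟨?_, ?_, ?_, ?_, ?_⟩, ⟨?_, ?_, ?_, ?_, ?_⟩⟩ <;> 
      (try simp only [show j + 2 - 1 = j + 1 by omega, map_mul _ (_ ^ _) _, map_pow _ _ (_ + _), M_γαβ, N_γαβ, L_γαβ, p_γαβ, q_γαβ]) <;> simp [← pow_succ]
  case rel_alpha_sq =>
    right; right; right; left
    refine ⟨⟨?_, ?_, ?_, ?_, ?_⟩, ⟨?_, ?_, ?_, ?_, ?_⟩⟩ <;> 
      (try simp only [show j + 2 - 1 = j + 1 by omega, map_mul _ (_ ^ _) _, map_pow _ _ (_ + _), map_add, map_smul, M_βγα, N_βγα, L_βγα, p_βγα, q_βγα]) <;> simp [← pow_succ, ← sq]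
    · rw [sq]; simp
  case rel_gamma_beta =>
    right; right; right; right
    refine ⟨⟨?_, ?_, ?_, ?_, ?_⟩, ⟨?_, ?_, ?_, ?_, ?_⟩⟩ <;> 
      (try simp only [show i + 3 - 1 = i + 2 by omega, map_pow, N_η]) <;> simp
  all_goals
    left
    refine ⟨_, _, _, _, _, ⟨rfl, rfl, rfl, rfl, rfl⟩, ⟨?_, ?_, ?_, ?_, ?_⟩⟩ <;> simp [add_mul, mul_add]
  all_goals
    ext1 u v
    fin_cases u <;> fin_cases v <;> simp [one_apply]

variable (K) in
noncomputable def tM (n : ℕ) : FreeAlgebra K Gen →ₗ[K] K where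
  toFun y := (trace (rM K y)).coeff n
  map_add' x y := by simp
  map_smul' r y := by simp

variable (K) in
noncomputable def tN (n : ℕ) : FreeAlgebra K Gen →ₗ[K] K where
  toFun y := (trace (rN K y)).coeff n
  map_add' x y := by simp
  map_smul' r y := by simp

variable (K) in
noncomputable def tL (n : ℕ) : FreeAlgebra K Gen →ₗ[K] K where
  toFun y := (trace (rL K y)).coeff n
  map_add' x y := by simp
  map_smul' r y := by simp

variable (K) in
noncomputable def tp (n : ℕ) : FreeAlgebra K Gen →ₗ[K] K where
  toFun y := (rp K y).coeff n
  map_add' x y := by simp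
  map_smul' r y := by simp

variable (K) in
noncomputable def tq (n : ℕ) : FreeAlgebra K Gen →ₗ[K] K where
  toFun y := (rq K y).coeff n
  map_add' x y := by simp
  map_smul' r y := by simp

theorem tM_s (n : ℕ) (x y) : tM K n (x * y) = tM K n (y * x) := by
  simp only [tM, LinearMap.coe_mk, AddHom.coe_mk, map_mul]; rw [trace_mul_comm]
theorem tN_s (n : ℕ) (x y) : tN K n (x * y) = tN K n (y * x) := by
  simp only [tN, LinearMap.coe_mk, AddHom.coe_mk, map_mul]; rw [trace_mul_comm]
theorem tL_s (n : ℕ) (x y) : tL K n (x * y) = tL K n (y * x) := by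
  simp only [tL, LinearMap.coe_mk, AddHom.coe_mk, map_mul]; rw [trace_mul_comm]
theorem tp_s (n : ℕ) (x y) : tp K n (x * y) = tp K n (y * x) := by
  simp only [tp, LinearMap.coe_mk, AddHom.coe_mk, map_mul]; rw [mul_comm]
theorem tq_s (n : ℕ) (x y) : tq K n (x * y) = tq K n (y * x) := by
  simp only [tq, LinearMap.coe_mk, AddHom.coe_mk, map_mul]; rw [mul_comm]

variable (K) in
/-- general functional -/
noncomputable def Psi (u1 u2 u3 u4 u5 u6 : K) (n1 n2 n3 n4 n5 n6 : ℕ) : FreeAlgebra K Gen →ₗ[K] K :=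
  u1 • tM K n1 + u2 • tN K n2 + u3 • tL K n3 + u4 • tp K n4 + u5 • tq K n5 + u6 • tq K n6

theorem Psi_apply (u1 u2 u3 u4 u5 u6 : K) (n1 n2 n3 n4 n5 n6 : ℕ) (x) :
    Psi K u1 u2 u3 u4 u5 u6 n1 n2 n3 n4 n5 n6 x = 
    u1 * (trace (rM K x)).coeff n1 + u2 * (trace (rN K x)).coeff n2 + u3 * (trace (rL K x)).coeff n3
     + u4 * (rp K x).coeff n4 + u5 * (rq K x).coeff n5 + u6 * (rq K x).coeff n6 := rfl

theorem Psi_tr {j i : ℕ} {a c : K} (u1 u2 u3 u4 u5 u6 : K) (n1 n2 n3 n4 n5 n6 : ℕ)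
    (h1 : ∀ y, u2 * (rN K y 2 0).coeff n2 = u1 * (X ^ (j + 1) * rM K y 2 0).coeff n1)
    (h2 : ∀ y, u2 * (X * rN K y 0 1).coeff n2 = u1 * (X ^ (j + 2) * rM K y 1 2).coeff n1)
    (h3 : ∀ y, u5 * (X ^ 2 * rq K y).coeff n5 + u6 * (X ^ 2 * rq K y).coeff n6 = 
      u1 * (a * (X ^ (j + 2) * rM K y 0 1).coeff n1 + c * (X ^ (j + 2) * rM K y 1 1).coeff n1))
    (h4 : ∀ y, u2 * (X * rN K y 1 2).coeff n2 + u3 * (X * rL K y 1 1).coeff n3 =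
      u4 * (X ^ (i + 2) * rp K y).coeff n4) :
    IsTr K (j + 2) (i + 3) a c (Psi K u1 u2 u3 u4 u5 u6 n1 n2 n3 n4 n5 n6) := by
  constructor
  · intro x y
    simp only [Psi, LinearMap.add_apply, LinearMap.smul_apply]
    rw [tM_s, tN_s, tL_s, tp_s, tq_s n5 x y, tq_s n6 x y]
  · intro l r hr y
    rw [Psi_apply, Psi_apply]
    simp only [map_mul]
    rcases rel_cases hr with ⟨M, N, L, p, q, ⟨a1, a2, a3, a4, a5⟩, ⟨b1, b2, b3, b4, b5⟩⟩ |
      ⟨⟨a1, a2, a3, a4, a5⟩, ⟨b1, b2, b3, b4, b5⟩⟩ | ⟨⟨a1, a2, a3, a4, a5⟩, ⟨b1, b2, b3, b4, b5⟩⟩ |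
      ⟨⟨a1, a2, a3, a4, a5⟩, ⟨b1, b2, b3, b4, b5⟩⟩ | ⟨⟨a1, a2, a3, a4, a5⟩, ⟨b1, b2, b3, b4, b5⟩⟩
    all_goals rw [a1, a2, a3, a4, a5, b1, b2, b3, b4, b5]
    · simpa [trace_single_mul] using h1 y
    · simpa [trace_single_mul] using h2 y
    · simpa [trace_single_mul, add_mul] using h3 y
    · simpa [trace_single_mul] using h4 y

end reps
end QT

namespace QT
section fin
open Polynomial Matrix Gen

variable {K : Type} [Field K]

theorem Psi_e1 (u1 u2 u3 u4 u5 u6 : K) (n1 n2 n3 n4 n5 n6 : ℕ) :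
    Psi K u1 u2 u3 u4 u5 u6 n1 n2 n3 n4 n5 n6 (gen K e1 ^ 2) =
    u1 * (if n1 = 0 then 1 + 1 else 0) + u2 * (if n2 = 0 then 1 else 0) + u3 * (if n3 = 0 then 1 else 0)
      + u5 * (if n5 = 0 then 1 else 0) + u6 * (if n6 = 0 then 1 else 0) := by
  rw [Psi_apply, sq]
  simp [add_mul, mul_add, coeff_one]
  split_ifs <;> ring

theorem Psi_e2 (u1 u2 u3 u4 u5 u6 : K) (n1 n2 n3 n4 n5 n6 : ℕ) :
    Psi K u1 u2 u3 u4 u5 u6 n1 n2 n3 n4 n5 n6 (gen K e2 ^ 2) =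
    u1 * (if n1 = 0 then 1 else 0) + u2 * (if n2 = 0 then 1 + 1 else 0) + u3 * (if n3 = 0 then 1 else 0)
      + u4 * (if n4 = 0 then 1 else 0) := by
  rw [Psi_apply, sq]
  simp [add_mul, mul_add, coeff_one]
  split_ifs <;> ring

theorem Psi_al (u1 u2 u3 u4 u5 u6 : K) (n1 n2 n3 n4 n5 n6 : ℕ) :
    Psi K u1 u2 u3 u4 u5 u6 n1 n2 n3 n4 n5 n6 (gen K al ^ 2) =
    u5 * (if n5 = 2 then 1 else 0) + u6 * (if n6 = 2 then 1 else 0) := by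
  rw [Psi_apply, map_pow, map_pow, map_pow, map_pow, map_pow, rM_al, sq (single 0 1 1)]
  simp [coeff_X_pow]

theorem Psi_et (u1 u2 u3 u4 u5 u6 : K) (n1 n2 n3 n4 n5 n6 : ℕ) (t : ℕ) (ht : 1 ≤ t) :
    Psi K u1 u2 u3 u4 u5 u6 n1 n2 n3 n4 n5 n6 ((gen K et ^ t) ^ 2) =
    u4 * (if n4 = 2 * t then 1 else 0) := by
  obtain ⟨t, rfl⟩ : ∃ i, t = i + 1 := ⟨t - 1, by omega⟩
  rw [Psi_apply, ← pow_mul, show (t + 1) * 2 = 2 * t + 2 by ring]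
  simp only [map_pow, N_η]
  simp [coeff_X_pow, mul_add]

theorem Psi_x (u1 u2 u3 u4 u5 u6 : K) (n1 n2 n3 n4 n5 n6 : ℕ) (t : ℕ) (ht : 1 ≤ t) :
    Psi K u1 u2 u3 u4 u5 u6 n1 n2 n3 n4 n5 n6 (((gen K be * gen K ga * gen K al) ^ t) ^ 2) =
    u1 * (if n1 = 2 * t then 1 else 0) := by
  obtain ⟨t, rfl⟩ : ∃ i, t = i + 1 := ⟨t - 1, by omega⟩
  rw [Psi_apply, ← pow_mul, show (t + 1) * 2 = 2 * t + 1 + 1 by ring]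
  simp only [map_pow, M_βγα, N_βγα, L_βγα, p_βγα, q_βγα]
  simp [coeff_X_pow, mul_add]

theorem tr_e1 {j i : ℕ} {a c : K} : IsTr K (j + 2) (i + 3) a c (Psi K 0 0 0 0 1 0 0 0 0 0 0 0) := by
  apply Psi_tr <;> intro y <;> simp

theorem tr_eta {j i : ℕ} {a c : K} (n : ℕ) (hn : n ≤ i + 1) :
    IsTr K (j + 2) (i + 3) a c (Psi K 0 0 0 1 0 0 0 0 0 n 0 0) := by
  apply Psi_tr <;> intro y <;> simp [coeff_X_pow_mul']
  omega

theorem tr_eta' {j i : ℕ} {a c : K} :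
    IsTr K (j + 2) (i + 3) a c (Psi K 0 0 1 1 0 0 0 0 1 (i + 2) 0 0) := by
  apply Psi_tr <;> intro y <;> simp [coeff_X_pow_mul', coeff_X_mul]
  exact (good K y).L11

theorem tr_x {j i : ℕ} {a c : K} (n : ℕ) (hn : n ≤ j + 1) :
    IsTr K (j + 2) (i + 3) a c (Psi K 1 0 0 0 0 0 n 0 0 0 0 0) := by
  have h : ¬ (j + 2 ≤ n) := by omega
  apply Psi_tr <;> intro y <;> simp [coeff_X_pow_mul', h]
  intro h
  rw [show n - (j + 1) = 0 by omega, (good K y).M20]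

theorem tr_psi {j i : ℕ} {a c : K} :
    IsTr K (j + 2) (i + 3) a c (Psi K 1 1 0 1 c a (j + 2) 1 0 (i + 3) 2 3) := by
  apply Psi_tr <;> intro y
  · simp [coeff_X_pow_mul', (good K y).MN, show j + 2 - (j + 1) = 1 by omega]
  · simp [coeff_X_pow_mul', coeff_X_mul, (good K y).N01]
  · simp [coeff_X_pow_mul', (good K y).M01, (good K y).M11]; ring
  · simp [coeff_X_pow_mul', coeff_X_mul, (good K y).N12, show i + 3 - (i + 2) = 1 by omega]

theorem qrep (k s : ℕ) (a c : K) : QRep k s a c (E1 K k s a c) (E2 K k s a c) (Al K k s a c)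
    (Be K k s a c) (Ga K k s a c) (Et K k s a c) := by
  have h := fun l r (h : Rel K k s a c l r) => RingQuot.mkAlgHom_rel K h
  constructor
  · simpa only [E1, E2, Al, Be, Ga, Et, map_mul, map_add, map_pow, map_smul, map_one, map_zero] using h _ _ .idem1
  · simpa only [E1, E2, Al, Be, Ga, Et, map_mul, map_add, map_pow, map_smul, map_one, map_zero] using h _ _ .idem2
  · simpa only [E1, E2, Al, Be, Ga, Et, map_mul, map_add, map_pow, map_smul, map_one, map_zero] using h _ _ .orth12
  · simpa only [E1, E2, Al, Be, Ga, Et, map_mul, map_add, map_pow, map_smul, map_one, map_zero] using h _ _ .orth21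
  · simpa only [E1, E2, Al, Be, Ga, Et, map_mul, map_add, map_pow, map_smul, map_one, map_zero] using h _ _ .sum_idem
  · simpa only [E1, E2, Al, Be, Ga, Et, map_mul, map_add, map_pow, map_smul, map_one, map_zero] using h _ _ .al_left
  · simpa only [E1, E2, Al, Be, Ga, Et, map_mul, map_add, map_pow, map_smul, map_one, map_zero] using h _ _ .al_right
  · simpa only [E1, E2, Al, Be, Ga, Et, map_mul, map_add, map_pow, map_smul, map_one, map_zero] using h _ _ .be_left
  · simpa only [E1, E2, Al, Be, Ga, Et, map_mul, map_add, map_pow, map_smul, map_one, map_zero] using h _ _ .be_right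
  · simpa only [E1, E2, Al, Be, Ga, Et, map_mul, map_add, map_pow, map_smul, map_one, map_zero] using h _ _ .ga_left
  · simpa only [E1, E2, Al, Be, Ga, Et, map_mul, map_add, map_pow, map_smul, map_one, map_zero] using h _ _ .ga_right
  · simpa only [E1, E2, Al, Be, Ga, Et, map_mul, map_add, map_pow, map_smul, map_one, map_zero] using h _ _ .et_left
  · simpa only [E1, E2, Al, Be, Ga, Et, map_mul, map_add, map_pow, map_smul, map_one, map_zero] using h _ _ .et_right
  · simpa only [E1, E2, Al, Be, Ga, Et, map_mul, map_add, map_pow, map_smul, map_one, map_zero] using h _ _ .rel_beta_eta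
  · simpa only [E1, E2, Al, Be, Ga, Et, map_mul, map_add, map_pow, map_smul, map_one, map_zero] using h _ _ .rel_eta_gamma
  · simpa only [E1, E2, Al, Be, Ga, Et, map_mul, map_add, map_pow, map_smul, map_one, map_zero] using h _ _ .rel_alpha_sq
  · simpa only [E1, E2, Al, Be, Ga, Et, map_mul, map_add, map_pow, map_smul, map_one, map_zero] using h _ _ .rel_gamma_beta
  · simpa only [E1, E2, Al, Be, Ga, Et, map_mul, map_add, map_pow, map_smul, map_one, map_zero] using h _ _ .rel_alpha_sq_beta
  · simpa only [E1, E2, Al, Be, Ga, Et, map_mul, map_add, map_pow, map_smul, map_one, map_zero] using h _ _ .rel_gamma_alpha_sq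

variable {k s : ℕ} {a c : K}

theorem GS_top (hk : 1 < k) (hs : 3 ≤ s) (z : Aa K k s a c) :
    z ∈ QRep.GS K (E1 K k s a c) (E2 K k s a c) (Al K k s a c)
    (Be K k s a c) (Ga K k s a c) (Et K k s a c) := by
  obtain ⟨y, rfl⟩ := RingQuot.mkAlgHom_surjective K (Rel K k s a c) z
  have H := qrep k s a c
  suffices h : ∀ w ∈ QRep.GS K (E1 K k s a c) (E2 K k s a c) (Al K k s a c)
    (Be K k s a c) (Ga K k s a c) (Et K k s a c), w * RingQuot.mkAlgHom K (Rel K k s a c) y ∈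
      QRep.GS K (E1 K k s a c) (E2 K k s a c) (Al K k s a c)
    (Be K k s a c) (Ga K k s a c) (Et K k s a c) by
    simpa using h 1 H.GS_one
  induction y with
  | grade0 r =>
    intro w hw
    rw [AlgHom.commutes, ← Algebra.commutes, ← Algebra.smul_def]
    exact Submodule.smul_mem _ _ hw
  | grade1 g =>
    intro w hw
    refine H.GS_mul hk hs ?_ hw
    cases g
    · left; rfl
    · right; left; rfl
    · right; right; left; rfl
    · right; right; right; left; rfl
    · right; right; right; right; left; rfl
    · right; right; right; right; right; rfl
  | mul x y hx hy =>
    intro w hw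
    rw [map_mul, ← mul_assoc]
    exact hy _ (hx _ hw)
  | add x y hx hy =>
    intro w hw
    rw [map_add, mul_add]
    exact Submodule.add_mem _ (hx _ hw) (hy _ hw)

theorem hComm (u v : Aa K k s a c) : u * v - v * u ∈ comm K k s a c :=
  Submodule.subset_span ⟨u, v, rfl⟩

variable [CharP K 2]

variable (K k s a c) in
noncomputable def T1s : Submodule K (Aa K k s a c) where
  carrier := T1 K k s a c
  zero_mem' := by
    change (0 : Aa K k s a c) ^ 2 ∈ comm K k s a c
    rw [sq, zero_mul]; exact Submodule.zero_mem _
  add_mem' := by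
    intro x y hx hy
    change (x + y) ^ 2 ∈ comm K k s a c
    have := Submodule.add_mem _ (QRep.sq_add (K := K) hComm x y) (Submodule.add_mem _ hx hy)
    rwa [sub_add_cancel] at this
  smul_mem' := by
    intro r x hx
    change (r • x) ^ 2 ∈ comm K k s a c
    rw [_root_.smul_pow]
    exact Submodule.smul_mem _ _ hx

theorem mem_T1s {z : Aa K k s a c} : z ∈ T1s K k s a c ↔ z ^ 2 ∈ comm K k s a c := Iff.rfl

theorem comm_le : comm K k s a c ≤ T1s K k s a c := by
  refine Submodule.span_le.2 ?_
  rintro _ ⟨u, v, rfl⟩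
  exact QRep.sq_comm hComm u v

variable (K k s a c) in
noncomputable def S0 : Submodule K (Aa K k s a c) :=
  comm K k s a c ⊔ Submodule.span K (etaAbove K k s a c s ∪ cycAbove K k s a c (k - 1))

theorem S0_le (hk : 1 < k) (hkodd : Odd k) (hs : 3 ≤ s) : S0 K k s a c ≤ T1s K k s a c := by
  have H := qrep k s a c
  refine sup_le comm_le (Submodule.span_le.2 ?_)
  rintro _ (⟨t, h1, h2, rfl⟩ | ⟨m, h1, h2, rfl⟩)
  · rw [SetLike.mem_coe, mem_T1s, ← pow_mul, H.z_η hk hs (by omega)]; exact Submodule.zero_mem _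
  · obtain ⟨u, hu⟩ := hkodd
    rw [SetLike.mem_coe, mem_T1s, ← pow_mul, H.z_x hk hs (by omega)]; exact Submodule.zero_mem _

/-- the quadratic additive map -/
theorem tr_sq {Ψ : FreeAlgebra K Gen →ₗ[K] K} (h : IsTr K k s a c Ψ) :
    ∃ Q : Aa K k s a c →+ K, (∀ z ∈ T1s K k s a c, Q z = 0) ∧ (∀ (r : K) z, Q (r • z) = r ^ 2 * Q z) ∧
     ∀ y, Q (RingQuot.mkAlgHom K (Rel K k s a c) y) = Ψ (y ^ 2) := by
  obtain ⟨φ, h1, h2⟩ := h.desc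
  refine ⟨AddMonoidHom.mk' (fun z => φ (z ^ 2)) ?_, ?_, ?_, ?_⟩
  · intro x y
    have := h2 _ (QRep.sq_add (K := K) hComm x y)
    rwa [map_sub, map_add, sub_eq_zero] at this
  · intro z hz; exact h2 _ hz
  · intro r z
    change φ ((r • z) ^ 2) = r ^ 2 * φ (z ^ 2)
    rw [_root_.smul_pow, map_smul]; rfl
  · intro y
    change φ (_ ^ 2) = _
    rw [← map_pow, h1]

theorem Psi_sq {u1 u2 u3 u4 u5 u6 : K} {n1 n2 n3 n4 n5 n6 : ℕ}
    (h : IsTr K k s a c (Psi K u1 u2 u3 u4 u5 u6 n1 n2 n3 n4 n5 n6)) (x1 x2 xa : K) (y w : ℕ → K)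
    (T M : ℕ)
    (hz : x1 • E1 K k s a c + x2 • E2 K k s a c + xa • Al K k s a c +
      ∑ t ∈ Finset.Icc 1 T, y t • Et K k s a c ^ t +
      ∑ m ∈ Finset.Icc 1 M, w m • (Be K k s a c * Ga K k s a c * Al K k s a c) ^ m ∈ T1s K k s a c) :
    x1 ^ 2 * (u1 * (if n1 = 0 then 1 + 1 else 0) + u2 * (if n2 = 0 then 1 else 0) +
      u3 * (if n3 = 0 then 1 else 0) + u5 * (if n5 = 0 then 1 else 0) +
      u6 * (if n6 = 0 then 1 else 0)) +
    x2 ^ 2 * (u1 * (if n1 = 0 then 1 else 0) + u2 * (if n2 = 0 then 1 + 1 else 0) +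
      u3 * (if n3 = 0 then 1 else 0) + u4 * (if n4 = 0 then 1 else 0)) +
    xa ^ 2 * (u5 * (if n5 = 2 then 1 else 0) + u6 * (if n6 = 2 then 1 else 0)) +
    ∑ t ∈ Finset.Icc 1 T, y t ^ 2 * (u4 * (if n4 = 2 * t then 1 else 0)) + 
    ∑ m ∈ Finset.Icc 1 M, w m ^ 2 * (u1 * (if n1 = 2 * m then 1 else 0)) = 0 := by
  obtain ⟨Q, h1, h2, h3⟩ := tr_sq h
  have := h1 _ hz
  simp only [map_add, map_sum, h2] at this
  refine Eq.trans ?_ this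
  congr 1
  congr 1
  congr 1
  congr 1
  · rw [← Psi_e1 u1 u2 u3 u4 u5 u6 n1 n2 n3 n4 n5 n6, ← h3]; rfl
  · rw [← Psi_e2 u1 u2 u3 u4 u5 u6 n1 n2 n3 n4 n5 n6, ← h3]; rfl
  · rw [← Psi_al u1 u2 u3 u4 u5 u6 n1 n2 n3 n4 n5 n6, ← h3]; rfl
  · refine Finset.sum_congr rfl fun t ht => ?_
    rw [← Psi_et u1 u2 u3 u4 u5 u6 n1 n2 n3 n4 n5 n6 t (Finset.mem_Icc.1 ht).1, ← h3, map_pow]; rfl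
  · refine Finset.sum_congr rfl fun t ht => ?_
    rw [← Psi_x u1 u2 u3 u4 u5 u6 n1 n2 n3 n4 n5 n6 t (Finset.mem_Icc.1 ht).1, ← h3, map_pow, map_mul,
      map_mul]; rfl

theorem main (hk : 1 < k) (hkodd : Odd k) (hs : 3 ≤ s) {z : Aa K k s a c} (hz : z ∈ T1 K k s a c) :
    ∃ xa y : K, z - (xa • Al K k s a c + y • Et K k s a c ^ (s / 2)) ∈ S0 K k s a c ∧
      c * xa ^ 2 + y ^ 2 = 0 ∧ (Odd s → y = 0) := by
  have H := qrep k s a c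
  have hW := H.GS_le hk hs (W := S0 K k s a c ⊔ Submodule.span K {E1 K k s a c} ⊔
    Submodule.span K {E2 K k s a c} ⊔ Submodule.span K {Al K k s a c} ⊔
    Submodule.span K ((fun t => Et K k s a c ^ t) '' ↑(Finset.Icc 1 (s / 2))) ⊔
    Submodule.span K ((fun m => (Be K k s a c * Ga K k s a c * Al K k s a c) ^ m) ''
      ↑(Finset.Icc 1 ((k - 1) / 2)))) ?_ ?_ ?_ ?_ ?_ ?_ (GS_top hk hs z)
  · simp only [Submodule.mem_sup, Submodule.mem_span_singleton,
      Submodule.mem_span_image_finset_iff_exists_fun'] at hW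
    obtain ⟨_, ⟨_, ⟨_, ⟨_, ⟨r, hr, _, ⟨x1, rfl⟩, rfl⟩, _, ⟨x2, rfl⟩, rfl⟩, _, ⟨xa, rfl⟩, rfl⟩, _, ⟨y, rfl⟩, rfl⟩,
      _, ⟨w, rfl⟩, hW⟩ := hW
    have hz' : x1 • E1 K k s a c + x2 • E2 K k s a c + xa • Al K k s a c +
      ∑ t ∈ Finset.Icc 1 (s / 2), y t • Et K k s a c ^ t +
      ∑ m ∈ Finset.Icc 1 ((k - 1) / 2), w m • (Be K k s a c * Ga K k s a c * Al K k s a c) ^ m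
        ∈ T1s K k s a c := by
      have := Submodule.sub_mem (T1s K k s a c) hz (S0_le hk hkodd hs hr)
      convert this using 1
      rw [← hW]; abel
    obtain ⟨j, rfl⟩ : ∃ j, k = j + 2 := ⟨k - 2, by omega⟩
    obtain ⟨i, rfl⟩ : ∃ j, s = j + 3 := ⟨s - 3, by omega⟩
    have g1 : x1 = 0 := by
      have := Psi_sq tr_e1 _ _ _ _ _ _ _ hz'
      simpa using this
    have g2 : x2 = 0 := by
      have := Psi_sq (tr_eta 0 (by omega)) _ _ _ _ _ _ _ hz'
      have h0 : ∑ t ∈ Finset.Icc 1 ((i + 3) / 2), y t ^ 2 * (1 * (if 0 = 2 * t then 1 else 0)) = 0 := by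
        refine Finset.sum_eq_zero fun t ht => ?_
        have := (Finset.mem_Icc.1 ht).1
        rw [if_neg (by omega)]; simp
      rw [h0] at this
      simpa using this
    have gs : ∀ t0 T : ℕ, ∀ f : ℕ → K, 1 ≤ t0 → t0 ≤ T → 
        ∑ t ∈ Finset.Icc 1 T, f t ^ 2 * (1 * (if 2 * t0 = 2 * t then 1 else 0)) = f t0 ^ 2 := by
      intro t0 T f h1 h2
      rw [Finset.sum_eq_single t0]
      · simp
      · intro b _ hb
        rw [if_neg (by omega)]; simp
      · intro h; exact absurd (Finset.mem_Icc.2 ⟨h1, h2⟩) h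
    have g3 : ∀ t, 1 ≤ t → 2 * t < i + 3 → y t = 0 := by
      intro t h1 h2
      have e := gs t ((i + 3) / 2) y h1 (by omega)
      by_cases h : 2 * t = i + 2
      · have := Psi_sq tr_eta' _ _ _ _ _ _ _ hz'
        rw [← h, e] at this
        simpa [show t ≠ 0 by omega] using this
      · have := Psi_sq (tr_eta (2 * t) (by omega)) _ _ _ _ _ _ _ hz'
        rw [e] at this
        simpa [show t ≠ 0 by omega] using this
    have g4 : ∀ t, 1 ≤ t → 2 * t < j + 2 → w t = 0 := by
      intro t h1 h2
      have e := gs t ((j + 2 - 1) / 2) w h1 (by omega)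
      have := Psi_sq (tr_x (2 * t) (by omega)) _ _ _ _ _ _ _ hz'
      rw [e] at this
      simpa [show t ≠ 0 by omega] using this
    have hw : ∑ m ∈ Finset.Icc 1 ((j + 2 - 1) / 2), w m • (Be K (j + 2) (i + 3) a c * Ga K (j + 2) (i + 3) a c *
        Al K (j + 2) (i + 3) a c) ^ m = 0 := by
      refine Finset.sum_eq_zero fun t ht => ?_
      have := Finset.mem_Icc.1 ht
      rw [g4 t this.1 (by omega), zero_smul]
    have hy : ∑ t ∈ Finset.Icc 1 ((i + 3) / 2), y t • Et K (j + 2) (i + 3) a c ^ t = 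
        y ((i + 3) / 2) • Et K (j + 2) (i + 3) a c ^ ((i + 3) / 2) := by
      rw [Finset.sum_eq_single ((i + 3) / 2)]
      · intro b hb hne
        have := Finset.mem_Icc.1 hb
        rw [g3 b this.1 (by omega), zero_smul]
      · intro h
        exact absurd (Finset.mem_Icc.2 ⟨by omega, le_refl _⟩) h
    have g5 := Psi_sq tr_psi _ _ _ _ _ _ _ hz'
    have hodd : Odd (i + 3) → y ((i + 3) / 2) = 0 := by
      rintro ⟨u, hu⟩
      exact g3 _ (by omega) (by omega)
    refine ⟨xa, y ((i + 3) / 2), ?_, ?_, hodd⟩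
    · rw [← hW, hw, hy, g1, g2]
      convert hr using 1
      module
    · have h0 : ∑ m ∈ Finset.Icc 1 ((j + 2 - 1) / 2), w m ^ 2 * (1 * (if j + 2 = 2 * m then 1 else 0)) = 0 := by
        refine Finset.sum_eq_zero fun t ht => ?_
        have := Finset.mem_Icc.1 ht
        rw [g4 t this.1 (by omega)]; simp
      have h1 : ∑ t ∈ Finset.Icc 1 ((i + 3) / 2), y t ^ 2 * (1 * (if i + 3 = 2 * t then 1 else 0)) =
          y ((i + 3) / 2) ^ 2 := by
        rcases Nat.even_or_odd (i + 3) with he | ho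
        · obtain ⟨u, hu⟩ := he
          have := gs ((i + 3) / 2) ((i + 3) / 2) y (by omega) le_rfl
          rwa [show 2 * ((i + 3) / 2) = i + 3 by omega] at this
        · rw [hodd ho]
          refine (Finset.sum_eq_zero fun t ht => ?_).trans (by simp)
          obtain ⟨u, hu⟩ := ho
          rw [if_neg (by omega)]; simp
      rw [h0, h1, g1, g2] at g5
      simpa [mul_comm] using g5
  · intro u v
    exact Submodule.mem_sup_left (Submodule.mem_sup_left (Submodule.mem_sup_left
      (Submodule.mem_sup_left (Submodule.mem_sup_left (Submodule.mem_sup_left (hComm u v))))))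
  · exact Submodule.mem_sup_left (Submodule.mem_sup_left (Submodule.mem_sup_left
      (Submodule.mem_sup_left (Submodule.mem_sup_right (Submodule.mem_span_singleton_self _)))))
  · exact Submodule.mem_sup_left (Submodule.mem_sup_left (Submodule.mem_sup_left
      (Submodule.mem_sup_right (Submodule.mem_span_singleton_self _))))
  · exact Submodule.mem_sup_left (Submodule.mem_sup_left
      (Submodule.mem_sup_right (Submodule.mem_span_singleton_self _)))
  · intro t h1 h2
    by_cases h : t ≤ s / 2
    · exact Submodule.mem_sup_left (Submodule.mem_sup_right
        (Submodule.subset_span ⟨t, by simp; omega, rfl⟩))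
    · exact Submodule.mem_sup_left (Submodule.mem_sup_left (Submodule.mem_sup_left
        (Submodule.mem_sup_left (Submodule.mem_sup_left (Submodule.mem_sup_right
          (Submodule.subset_span (Or.inl ⟨t, by omega, by omega, rfl⟩)))))))
  · intro t h1 h2
    by_cases h : t ≤ (k - 1) / 2
    · exact Submodule.mem_sup_right
        (Submodule.subset_span ⟨t, by simp; omega, rfl⟩)
    · exact Submodule.mem_sup_left (Submodule.mem_sup_left (Submodule.mem_sup_left
        (Submodule.mem_sup_left (Submodule.mem_sup_left (Submodule.mem_sup_right
          (Submodule.subset_span (Or.inr ⟨t, by omega, by omega, rfl⟩)))))))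

/-- the upper bound half -/
theorem le_half {B : Set (Aa K k s a c)} :
    S0 K k s a c ≤ comm K k s a c ⊔ Submodule.span K
      (B ∪ etaAbove K k s a c s ∪ cycAbove K k s a c (k - 1)) := by
  refine sup_le_sup_left (Submodule.span_mono ?_) _
  rw [Set.union_assoc]
  exact Set.subset_union_right

theorem eq_of {b : Aa K k s a c} (hk : 1 < k) (hkodd : Odd k) (hs : 3 ≤ s) (hb : b ^ 2 ∈ comm K k s a c)
    (h : ∀ xa y : K, c * xa ^ 2 + y ^ 2 = 0 → (Odd s → y = 0) →
      ∃ r : K, xa • Al K k s a c + y • Et K k s a c ^ (s / 2) = r • b) :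
    (T1 K k s a c : Set (Aa K k s a c)) =
        ↑(comm K k s a c ⊔ Submodule.span K
          ({b} ∪ etaAbove K k s a c s ∪ cycAbove K k s a c (k - 1))) := by
  apply Set.Subset.antisymm
  · intro z hz
    obtain ⟨xa, y, h1, h2, h3⟩ := main hk hkodd hs hz
    obtain ⟨r, hr⟩ := h xa y h2 h3
    rw [hr] at h1
    have h4 : r • b ∈ comm K k s a c ⊔ Submodule.span K
          ({b} ∪ etaAbove K k s a c s ∪ cycAbove K k s a c (k - 1)) :=
      Submodule.smul_mem _ _ (Submodule.mem_sup_right (Submodule.subset_span (Or.inl (Or.inl rfl))))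
    have := Submodule.add_mem _ (le_half (B := {b}) h1) h4
    rwa [sub_add_cancel] at this
  · have : comm K k s a c ⊔ Submodule.span K
          ({b} ∪ etaAbove K k s a c s ∪ cycAbove K k s a c (k - 1)) ≤ T1s K k s a c := by
      rw [Set.union_assoc, Submodule.span_union, sup_left_comm]
      refine sup_le ?_ (S0_le hk hkodd hs)
      rw [Submodule.span_singleton_le_iff_mem]
      exact hb
    exact this
end fin
end QT
open QT in
/-- char K = 2, k > 1 odd.  In A = A^{k,s}(a,c):
(i) if c = 0 then T₁(A) = [A,A] + span({α} ∪ {η^t : s/2 < t ≤ s−1} ∪ {(βγα)^m : (k−1)/2 < m ≤ k});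
(ii) if c ≠ 0 and (s odd or c not a square), then T₁(A) = [A,A] + span({η^t : s/2 < t ≤ s−1} ∪ {(βγα)^m : (k−1)/2 < m ≤ k});
(iii) if s even and c = d² with d ≠ 0, then T₁(A) = [A,A] + span({α + dη^{s/2}} ∪ {η^t : s/2 < t ≤ s−1} ∪ {(βγα)^m : (k−1)/2 < m ≤ k}). -/
theorem statement8 (K : Type) [Field K] [CharP K 2] (k s : ℕ)
    (hk : 1 < k) (hkodd : Odd k) (hs : 3 ≤ s) (a c : K) (ha : a ≠ 0) :
    (c = 0 →
      (T1 K k s a c : Set (Aa K k s a c)) =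
        ↑(comm K k s a c ⊔ Submodule.span K
          ({Al K k s a c} ∪ etaAbove K k s a c s ∪ cycAbove K k s a c (k - 1)))) ∧
    (c ≠ 0 → (Odd s ∨ ¬ IsSquare c) →
      (T1 K k s a c : Set (Aa K k s a c)) =
        ↑(comm K k s a c ⊔ Submodule.span K
          (etaAbove K k s a c s ∪ cycAbove K k s a c (k - 1)))) ∧
    (∀ d : K, d ≠ 0 → c = d ^ 2 → Even s →
      (T1 K k s a c : Set (Aa K k s a c)) =
        ↑(comm K k s a c ⊔ Submodule.span K
          ({Al K k s a c + d • (Et K k s a c) ^ (s / 2)} ∪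
            etaAbove K k s a c s ∪ cycAbove K k s a c (k - 1)))) := by
  have H := qrep k s a c
  have h2 : (2 : K) = 0 := CharTwo.two_eq_zero
  refine ⟨?_, ?_, ?_⟩
  · intro hc
    refine eq_of hk hkodd hs ?_ ?_
    · have := H.αα_mem hk hs (W := comm K k s a c) hComm
      rwa [hc, zero_smul, sub_zero, ← hc] at this
    · intro xa y h _
      have hy : y = 0 := by simpa [hc] using h
      exact ⟨xa, by rw [hy, zero_smul, add_zero]⟩
  · intro hc hor
    have := eq_of (a := a) (c := c) (b := 0) hk hkodd hs (by rw [sq, zero_mul]; exact Submodule.zero_mem _) ?_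
    · rw [this, Set.union_assoc, Submodule.span_union, Submodule.span_zero_singleton, bot_sup_eq]
    · intro xa y h hy
      have hxa : xa = 0 := by
        by_contra hne
        rcases hor with ho | hsq
        · rw [hy ho] at h
          have : c * xa ^ 2 = 0 := by simpa using h
          simp_all
        · apply hsq
          refine ⟨y / xa, ?_⟩
          field_simp
          linear_combination h - y ^ 2 * h2
      have hy0 : y = 0 := by simpa [hxa] using h
      exact ⟨0, by rw [hxa, hy0]; simp⟩
  · intro d hd hc he
    refine eq_of hk hkodd hs ?_ ?_
    · have m1 := H.αα_mem hk hs (W := comm K k s a c) hComm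
      have m2 := H.ηs_mem hk hs (W := comm K k s a c) hComm
      have m3 := QRep.sq_add (K := K) (W := comm K k s a c) hComm (Al K k s a c) (d • Et K k s a c ^ (s / 2))
      have e : (d • Et K k s a c ^ (s / 2)) ^ 2 = c • Et K k s a c ^ s := by
        rw [_root_.smul_pow, ← hc, ← pow_mul, Nat.div_mul_cancel he.two_dvd]
      rw [e] at m3
      have := Submodule.add_mem _ m3 (Submodule.add_mem _ m1 (Submodule.smul_mem _ c m2))
      convert this using 1
      have h5 : (2 * c) • (Be K k s a c * Ga K k s a c * Al K k s a c) ^ k = 0 := by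
        rw [h2, zero_mul, zero_smul]
      rw [smul_sub, ← sub_eq_zero, ← h5]
      module
    · intro xa y h _
      have : (d * xa + y) ^ 2 = 0 := by
        rw [hc] at h
        linear_combination h + d * xa * y * h2
      have h6 : d * xa + y = 0 := by simpa using this
      have hy : y = xa * d := by linear_combination h6 - d * xa * h2
      exact ⟨xa, by rw [hy, smul_add, smul_smul]⟩
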